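/- For every natural number n ≥ 2, there exists a reduced-quaternion-valued inframonogenic homogeneous polynomial f of degree n which is not of the form ∂b∂ for any real-valued biharmonic homogeneous polynomial b of degree n + 2. Equivalently, the linear map b ↦ ∂b∂ from the space of real-valued biharmonic homogeneous polynomials of degree n + 2 to Infr_n is not surjective. -/

import Mathlib

noncomputable section

open MvPolynomial

/-- The space of real polynomials in the three variables `x₀, x₁, x₂`. -/
abbrev P3 := MvPolynomial (Fin 3) ℝ

/-- The partial derivative `∂ᵢ` as a linear operator on polynomials. -/
noncomputable def Dp (i : Fin 3) : P3 →ₗ[ℝ] P3 :=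
  (MvPolynomial.pderiv i).toLinearMap

/-- The linear map expressing the system `∂̄f∂̄ = 0` for a reduced-quaternion-valued
polynomial `f = f₀ + f₁e₁ + f₂e₂` (represented as a triple of real polynomials):
its kernel consists of the triples satisfying
`(∂₀² − ∂₁² − ∂₂²)f₀ − 2∂₀∂₁f₁ − 2∂₀∂₂f₂ = 0`,
`2∂₀∂₁f₀ + (∂₀² − ∂₁² + ∂₂²)f₁ − 2∂₁∂₂f₂ = 0`,
`2∂₀∂₂f₀ − 2∂₁∂₂f₁ + (∂₀² + ∂₁² − ∂₂²)f₂ = 0`. -/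
noncomputable def infrSystem : (Fin 3 → P3) →ₗ[ℝ] (Fin 3 → P3) :=
  LinearMap.pi ![
    (Dp 0 ∘ₗ Dp 0 - Dp 1 ∘ₗ Dp 1 - Dp 2 ∘ₗ Dp 2) ∘ₗ LinearMap.proj 0
      - (2:ℝ) • ((Dp 0 ∘ₗ Dp 1) ∘ₗ LinearMap.proj 1)
      - (2:ℝ) • ((Dp 0 ∘ₗ Dp 2) ∘ₗ LinearMap.proj 2),
    (2:ℝ) • ((Dp 0 ∘ₗ Dp 1) ∘ₗ LinearMap.proj 0)
      + (Dp 0 ∘ₗ Dp 0 - Dp 1 ∘ₗ Dp 1 + Dp 2 ∘ₗ Dp 2) ∘ₗ LinearMap.proj 1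
      - (2:ℝ) • ((Dp 1 ∘ₗ Dp 2) ∘ₗ LinearMap.proj 2),
    (2:ℝ) • ((Dp 0 ∘ₗ Dp 2) ∘ₗ LinearMap.proj 0)
      - (2:ℝ) • ((Dp 1 ∘ₗ Dp 2) ∘ₗ LinearMap.proj 1)
      + (Dp 0 ∘ₗ Dp 0 + Dp 1 ∘ₗ Dp 1 - Dp 2 ∘ₗ Dp 2) ∘ₗ LinearMap.proj 2 ]

/-- `Infr n`: the real vector space of reduced-quaternion-valued inframonogenic
homogeneous polynomials of degree `n`, as triples `(f₀, f₁, f₂)` of homogeneous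
polynomials of degree `n` satisfying the system `∂̄f∂̄ = 0`. -/
noncomputable def Infr (n : ℕ) : Submodule ℝ (Fin 3 → P3) :=
  (Submodule.pi Set.univ fun _ : Fin 3 => MvPolynomial.homogeneousSubmodule (Fin 3) ℝ n)
    ⊓ LinearMap.ker infrSystem

/-- The Laplacian `Δ = ∂₀² + ∂₁² + ∂₂²` on polynomials. -/
noncomputable def lapP : P3 →ₗ[ℝ] P3 :=
  Dp 0 ∘ₗ Dp 0 + Dp 1 ∘ₗ Dp 1 + Dp 2 ∘ₗ Dp 2

/-- For a real-valued polynomial `b`, the reduced-quaternion-valued polynomial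
`∂b∂ = Σᵢⱼ εᵢεⱼ (∂ᵢ∂ⱼb) eᵢeⱼ = (∂₀² − ∂₁² − ∂₂²)b − 2∂₀∂₁b e₁ − 2∂₀∂₂b e₂`,
written as a triple of real polynomials. -/
noncomputable def sandP (b : P3) : Fin 3 → P3 :=
  ![Dp 0 (Dp 0 b) - Dp 1 (Dp 1 b) - Dp 2 (Dp 2 b),
    (-2 : ℝ) • Dp 0 (Dp 1 b),
    (-2 : ℝ) • Dp 0 (Dp 2 b)]

/-- The real and imaginary parts of `(x₀ + i x₁) ^ n`. -/
noncomputable def complexPowParts : ℕ → P3 × P3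
  | 0 => (1, 0)
  | n + 1 =>
    (X 0 * (complexPowParts n).1 - X 1 * (complexPowParts n).2,
      X 0 * (complexPowParts n).2 + X 1 * (complexPowParts n).1)

theorem complexPowParts_isHomogeneous (n : ℕ) :
    (complexPowParts n).1.IsHomogeneous n ∧ (complexPowParts n).2.IsHomogeneous n := by
  induction n with
  | zero => exact ⟨isHomogeneous_one _ _, isHomogeneous_zero _ _ _⟩
  | succ n ih =>
    have hX (i : Fin 3) {p : P3} (hp : p.IsHomogeneous n) :
        (X i * p).IsHomogeneous (n + 1) := by
      simpa [add_comm] using (isHomogeneous_X ℝ i).mul hp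
    exact ⟨(hX 0 ih.1).sub (hX 1 ih.2), (hX 0 ih.2).add (hX 1 ih.1)⟩

theorem pderiv_two_complexPowParts (n : ℕ) :
    pderiv 2 (complexPowParts n).1 = 0 ∧ pderiv 2 (complexPowParts n).2 = 0 := by
  induction n with
  | zero => simp [complexPowParts]
  | succ n ih => simp [complexPowParts, ih.1, ih.2, pderiv_X]

theorem pderiv_complexPowParts_succ (n : ℕ) :
    pderiv 0 (complexPowParts (n + 1)).1 = (n + 1) * (complexPowParts n).1 ∧
    pderiv 0 (complexPowParts (n + 1)).2 = (n + 1) * (complexPowParts n).2 ∧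
    pderiv 1 (complexPowParts (n + 1)).1 = -((n + 1) * (complexPowParts n).2) ∧
    pderiv 1 (complexPowParts (n + 1)).2 = (n + 1) * (complexPowParts n).1 := by
  induction n with
  | zero => simp [complexPowParts, pderiv_X]
  | succ n ih =>
    obtain ⟨h1, h2, h3, h4⟩ := ih
    rw [complexPowParts]
    simp only [map_sub, map_add, pderiv_mul, pderiv_X, h1, h2, h3, h4]
    simp only [complexPowParts, Pi.single_apply]
    refine ⟨?_, ?_, ?_, ?_⟩ <;> simp <;> ring

theorem eval_complexPowParts (n : ℕ) :
    eval ![(1 : ℝ), 0, 0] (complexPowParts n).1 = 1 := by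
  induction n with
  | zero => simp [complexPowParts]
  | succ n ih => simp [complexPowParts, ih]

theorem Dp_apply (i : Fin 3) (p : P3) : Dp i p = pderiv i p := rfl

theorem Dp_comm (i j : Fin 3) (p : P3) : Dp i (Dp j p) = Dp j (Dp i p) := by
  have h : ⁅(pderiv i : Derivation ℝ P3 P3), (pderiv j : Derivation ℝ P3 P3)⁆ = 0 := by
    refine MvPolynomial.derivation_ext fun k => ?_
    simp [Derivation.commutator_apply, pderiv_X, Pi.single_apply, apply_ite]
  simpa [Dp_apply, Derivation.commutator_apply, sub_eq_zero] using DFunLike.congr_fun h p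

/-- Images of `sandP` satisfy the integrability condition `∂₂f₁ = ∂₁f₂`. -/
theorem Dp_two_sandP_one (b : P3) : Dp 2 (sandP b 1) = Dp 1 (sandP b 2) := by
  simp only [sandP, Matrix.cons_val, map_smul]
  rw [Dp_comm 2 0, Dp_comm 1 0, Dp_comm 2 1]

/-- A polynomial `g` in `x₀, x₁` that is harmonic gives the inframonogenic polynomial `g e₂`. -/
theorem single_two_mem_Infr {n : ℕ} {g : P3} (hg : g.IsHomogeneous n)
    (h2 : Dp 2 g = 0) (hΔ : Dp 0 (Dp 0 g) + Dp 1 (Dp 1 g) = 0) :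
    ![0, 0, g] ∈ Infr n := by
  refine ⟨?_, ?_⟩
  · rw [SetLike.mem_coe, Submodule.mem_pi]
    intro i _
    fin_cases i
    exacts [isHomogeneous_zero _ _ _, isHomogeneous_zero _ _ _, hg]
  · rw [SetLike.mem_coe, LinearMap.mem_ker]
    funext i
    fin_cases i <;> simp [infrSystem, h2, hΔ]

/-- for every `n ≥ 2` there is an inframonogenic homogeneous polynomial
of degree `n` which is not of the form `∂b∂` for any real-valued biharmonic
homogeneous polynomial `b` of degree `n + 2`. -/
theorem stmt16 (n : ℕ) (hn : 2 ≤ n) :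
    ∃ f ∈ Infr n, ∀ b : P3,
      b.IsHomogeneous (n + 2) → lapP (lapP b) = 0 → sandP b ≠ f := by
  obtain ⟨m, rfl⟩ : ∃ m, n = m + 2 := ⟨n - 2, by omega⟩
  obtain ⟨-, h02, -, h12⟩ := pderiv_complexPowParts_succ (m + 1)
  obtain ⟨-, h02', h11', -⟩ := pderiv_complexPowParts_succ m
  have hC (i : Fin 3) (p : P3) :
      pderiv i (((m + 1 : ℕ) + 1 : P3) * p) = ((m + 1 : ℕ) + 1 : P3) * pderiv i p := by
    rw [pderiv_mul]
    simp
  refine ⟨![0, 0, (complexPowParts (m + 2)).2], single_two_mem_Infr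
    (complexPowParts_isHomogeneous _).2 (pderiv_two_complexPowParts _).2 ?_, ?_⟩
  · simp only [Dp_apply]
    rw [h02, h12, hC, hC, h02', h11']
    ring
  · intro b _ _ h
    have key := Dp_two_sandP_one b
    rw [h] at key
    simp only [Matrix.cons_val, map_zero, Dp_apply] at key
    rw [h12] at key
    have := congrArg (eval ![(1 : ℝ), 0, 0]) key
    simp only [map_zero, map_mul, eval_complexPowParts, map_add, map_natCast, map_one] at this
    have : (0 : ℝ) < (m + 1 : ℕ) + 1 := by positivity
    linarith
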